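/- For α = (1/2,…,1/2), the series F_S(z) admits the Euler integral representation F_S(z) = (1/B(1/2,1/2)²) ∫₀¹∫₀¹ s₁^{-1/2}s₂^{-1/2}(1−s₁)^{-1/2}(1−s₂)^{-1/2}(1−z₁s₁−z₂s₂)^{-1/2}(1−z₃s₁−z₄s₂)^{-1/2} ds₁ ds₂, valid for real z₁,z₂,z₃,z₄ ≥ 0 with z₁+z₂ < 1 and z₃+z₄ < 1. -/

import Mathlib

open MeasureTheory intervalIntegral

/-- Pochhammer symbol `(a)_k = a (a+1) ⋯ (a+k-1)` for real `a`. -/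
noncomputable def poch (a : ℝ) (k : ℕ) : ℝ := ∏ i ∈ Finset.range k, (a + i)

/-- Coefficient of the series `F_S` with all parameters `αⱼ = 1/2`. -/
noncomputable def FScoef (n : ℕ × ℕ × ℕ × ℕ) : ℝ :=
  poch (1 / 2) (n.1 + n.2.2.1) * poch (1 / 2) (n.2.1 + n.2.2.2) *
      poch (1 / 2) (n.1 + n.2.1) * poch (1 / 2) (n.2.2.1 + n.2.2.2) /
    (poch 1 (n.1 + n.2.2.1) * poch 1 (n.2.1 + n.2.2.2) *
      (Nat.factorial n.1) * (Nat.factorial n.2.1) * (Nat.factorial n.2.2.1) * (Nat.factorial n.2.2.2))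

lemma poch_succ (a : ℝ) (k : ℕ) : poch a (k+1) = poch a k * (a + k) := by
  simp [poch, Finset.prod_range_succ]

lemma poch_pos {a : ℝ} (ha : 0 < a) (k : ℕ) : 0 < poch a k :=
  Finset.prod_pos fun i _ => by positivity

lemma poch_one (k : ℕ) : poch 1 k = Nat.factorial k := by
  induction k with
  | zero => simp [poch]
  | succ k ih => rw [poch_succ, ih, Nat.factorial_succ]; push_cast; ring

lemma Gamma_half (k : ℕ) : Real.Gamma ((k:ℝ) + 1/2) = poch (1/2) k * √Real.pi := by
  induction k with
  | zero => simpa [poch] using Real.Gamma_one_half_eq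
  | succ k ih =>
    rw [poch_succ, show ((k+1:ℕ):ℝ) + 1/2 = ((k:ℝ)+1/2) + 1 by push_cast; ring,
      Real.Gamma_add_one (by positivity), ih]; ring

lemma asc_eval (a : ℝ) (n : ℕ) : (ascPochhammer ℝ n).eval a = poch a n := by
  induction n with
  | zero => simp [poch]
  | succ n ih => rw [ascPochhammer_succ_eval, ih, poch_succ]

lemma choose_poch (n : ℕ) (a : ℝ) : Ring.choose (a + n - 1) n = poch a n / Nat.factorial n := by
  have h := Ring.factorial_nsmul_multichoose_eq_ascPochhammer a n
  rw [Polynomial.ascPochhammer_smeval_eq_eval, asc_eval] at h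
  rw [Ring.choose, show a + n - 1 - n + 1 = a by ring, ← h]
  have : (Nat.factorial n : ℝ) ≠ 0 := by positivity
  rw [nsmul_eq_mul]; field_simp

lemma binom_hasSum {t : ℝ} (h0 : 0 ≤ t) (h1 : t < 1) :
    HasSum (fun k : ℕ => poch (1/2) k / Nat.factorial k * t ^ k) ((1 - t) ^ (-(1/2) : ℝ)) := by
  have h := (Real.one_div_one_sub_rpow_hasFPowerSeriesOnBall_zero (1/2)).hasSum (y := t)
    (by simp [h1, Real.enorm_eq_ofReal h0])
  simp only [zero_add, FormalMultilinearSeries.ofScalars_apply_eq, choose_poch, smul_eq_mul] at h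
  rwa [Real.rpow_neg (by linarith), ← one_div]

lemma binom2 {x y : ℝ} (hx : 0 ≤ x) (hy : 0 ≤ y) (h : x + y < 1) :
    ∑' p : ℕ × ℕ, ENNReal.ofReal (poch (1/2) (p.1 + p.2) /
      (Nat.factorial p.1 * Nat.factorial p.2) * x ^ p.1 * y ^ p.2) =
      ENNReal.ofReal ((1 - x - y) ^ (-(1/2) : ℝ)) := by
  have hp : ∀ k, 0 < poch (1/2) k := poch_pos (by norm_num)
  rw [← Finset.HasAntidiagonal.sigmaAntidiagonalEquivProd.tsum_eq, ENNReal.tsum_sigma',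
    show 1 - x - y = 1 - (x + y) by ring, ← (binom_hasSum (add_nonneg hx hy) h).tsum_eq,
    ENNReal.ofReal_tsum_of_nonneg (fun k => by have := hp k; positivity)
      (binom_hasSum (add_nonneg hx hy) h).summable]
  refine tsum_congr fun k => ?_
  rw [tsum_fintype, Finset.univ_eq_attach]
  simp only [Finset.HasAntidiagonal.sigmaAntidiagonalEquivProd_apply]
  rw [Finset.sum_attach (Finset.HasAntidiagonal.antidiagonal k) (fun p => ENNReal.ofReal (poch (1/2) (p.1 + p.2) /
      (Nat.factorial p.1 * Nat.factorial p.2) * x ^ p.1 * y ^ p.2)),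
    ← ENNReal.ofReal_sum_of_nonneg (fun p _ => by have := hp (p.1+p.2); positivity)]
  congr 1
  rw [(Commute.all x y).add_pow', Finset.mul_sum]
  refine Finset.sum_congr rfl fun p hpk => ?_
  have hk := Finset.HasAntidiagonal.mem_antidiagonal.1 hpk
  subst hk
  rw [nsmul_eq_mul, Nat.choose_symm_add, Nat.add_choose, Nat.cast_div (Nat.factorial_mul_factorial_dvd_factorial_add _ _)
    (by positivity)]
  have : (Nat.factorial (p.1+p.2) : ℝ) ≠ 0 := by positivity
  push_cast
  field_simp

noncomputable def wt (s : ℝ) : ℝ := s ^ (-(1/2) : ℝ) * (1 - s) ^ (-(1/2) : ℝ)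

lemma wt_meas : Measurable wt := by unfold wt; fun_prop

lemma beta_lint (k : ℕ) : ∫⁻ s in Set.Ioo (0:ℝ) 1, ENNReal.ofReal (s ^ k * wt s) =
    ENNReal.ofReal (Real.pi * (poch (1/2) k / poch 1 k)) := by
  have hk : (0:ℝ) < (k:ℝ) + 1/2 := by positivity
  have hb := ProbabilityTheory.beta_pos hk (by norm_num : (0:ℝ) < 1/2)
  have h := ProbabilityTheory.lintegral_betaPDF_eq_one hk (by norm_num : (0:ℝ) < 1/2)
  have hbe : ProbabilityTheory.beta ((k:ℝ)+1/2) (1/2) = Real.pi * (poch (1/2) k / poch 1 k) := by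
    rw [ProbabilityTheory.beta, Gamma_half, Real.Gamma_one_half_eq,
      show (k:ℝ) + 1/2 + 1/2 = k + 1 by ring, Real.Gamma_nat_eq_factorial, poch_one]
    rw [mul_assoc, Real.mul_self_sqrt Real.pi_pos.le]; ring
  rw [← hbe]
  rw [ProbabilityTheory.lintegral_betaPDF] at h
  set b := ProbabilityTheory.beta ((k:ℝ)+1/2) (1/2)
  have h2 : ∫⁻ s in Set.Ioo (0:ℝ) 1, ENNReal.ofReal (s ^ k * wt s) =
     ∫⁻ s in Set.Ioo (0:ℝ) 1, ENNReal.ofReal b * ENNReal.ofReal (1 / b * s ^ ((k:ℝ) + 1/2 - 1) * (1 - s) ^ ((1/2:ℝ) - 1)) := by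
    refine setLIntegral_congr_fun measurableSet_Ioo fun s hs => ?_
    rw [← ENNReal.ofReal_mul hb.le]
    congr 1
    rw [show (k:ℝ) + 1/2 - 1 = -(1/2) + k by ring, Real.rpow_add_natCast hs.1.ne', wt,
      show (1/2:ℝ) - 1 = -(1/2) by norm_num]
    field_simp
  rw [h2, lintegral_const_mul _ (by fun_prop), h, mul_one]

noncomputable def mu : Measure ℝ := volume.restrict (Set.Ioo (0:ℝ) 1)
instance : SigmaFinite mu := by unfold mu; infer_instance

lemma wt_nonneg {s : ℝ} (h : s ∈ Set.Ioo (0:ℝ) 1) : 0 ≤ wt s :=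
  mul_nonneg (Real.rpow_nonneg h.1.le _) (Real.rpow_nonneg (by linarith [h.2]) _)

lemma mu_ae : ∀ᵐ s ∂mu, s ∈ Set.Ioo (0:ℝ) 1 := ae_restrict_mem measurableSet_Ioo

lemma mu2_ae : ∀ᵐ s ∂(mu.prod mu), s.1 ∈ Set.Ioo (0:ℝ) 1 ∧ s.2 ∈ Set.Ioo (0:ℝ) 1 :=
  (Measure.quasiMeasurePreserving_fst.ae mu_ae).and (Measure.quasiMeasurePreserving_snd.ae mu_ae)

lemma wt_int : Integrable wt mu := by
  refine ⟨wt_meas.aestronglyMeasurable, ?_⟩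
  rw [hasFiniteIntegral_iff_ofReal (mu_ae.mono fun s hs => wt_nonneg hs)]
  have := beta_lint 0
  simp only [pow_zero, one_mul] at this
  rw [mu, this]; exact ENNReal.ofReal_lt_top

noncomputable def FF (z₁ z₂ z₃ z₄ : ℝ) (s : ℝ × ℝ) : ℝ := wt s.1 * wt s.2 *
    ((1 - z₁ * s.1 - z₂ * s.2) ^ (-(1 / 2) : ℝ) * (1 - z₃ * s.1 - z₄ * s.2) ^ (-(1 / 2) : ℝ))

lemma FF_meas (z₁ z₂ z₃ z₄ : ℝ) : Measurable (FF z₁ z₂ z₃ z₄) := by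
  have := wt_meas
  unfold FF; fun_prop

lemma lin_le {z w s t : ℝ} (hz : 0 ≤ z) (hw : 0 ≤ w) (hs : s ∈ Set.Ioo (0:ℝ) 1)
    (ht : t ∈ Set.Ioo (0:ℝ) 1) : 1 - (z + w) ≤ 1 - z * s - w * t := by
  nlinarith [mul_nonneg hz (sub_nonneg.2 hs.2.le), mul_nonneg hw (sub_nonneg.2 ht.2.le)]

lemma rp_le {a b : ℝ} (ha : 0 < a) (hab : a ≤ b) : b ^ (-(1/2):ℝ) ≤ a ^ (-(1/2):ℝ) :=
  Real.rpow_le_rpow_of_nonpos ha hab (by norm_num)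

section
variable (z₁ z₂ z₃ z₄ : ℝ) (h1 : 0 ≤ z₁) (h2 : 0 ≤ z₂) (h3 : 0 ≤ z₃)
    (h4 : 0 ≤ z₄) (h12 : z₁ + z₂ < 1) (h34 : z₃ + z₄ < 1)
include h1 h2 h3 h4 h12 h34

lemma FF_nonneg : ∀ᵐ s ∂(mu.prod mu), 0 ≤ FF z₁ z₂ z₃ z₄ s := by
  filter_upwards [mu2_ae] with s hs
  have ha := lin_le h1 h2 hs.1 hs.2
  have hb := lin_le h3 h4 hs.1 hs.2
  exact mul_nonneg (mul_nonneg (wt_nonneg hs.1) (wt_nonneg hs.2))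
    (mul_nonneg (Real.rpow_nonneg (by linarith) _) (Real.rpow_nonneg (by linarith) _))

lemma FF_int : Integrable (FF z₁ z₂ z₃ z₄) (mu.prod mu) := by
  refine ((wt_int.mul_prod wt_int).mul_const ((1 - (z₁ + z₂)) ^ (-(1/2):ℝ) *
    (1 - (z₃ + z₄)) ^ (-(1/2):ℝ))).mono' (FF_meas _ _ _ _).aestronglyMeasurable ?_
  filter_upwards [mu2_ae, FF_nonneg z₁ z₂ z₃ z₄ h1 h2 h3 h4 h12 h34] with s hs h0
  rw [Real.norm_of_nonneg h0, FF]
  have ha := lin_le h1 h2 hs.1 hs.2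
  have hb := lin_le h3 h4 hs.1 hs.2
  refine mul_le_mul_of_nonneg_left (mul_le_mul (rp_le (by linarith) ha) (rp_le (by linarith) hb)
    (Real.rpow_nonneg (by linarith) _) (Real.rpow_nonneg (by linarith) _))
    (mul_nonneg (wt_nonneg hs.1) (wt_nonneg hs.2))

lemma FF_lint : ∫⁻ s, ENNReal.ofReal (FF z₁ z₂ z₃ z₄ s) ∂(mu.prod mu) =
    ∑' n : ℕ × ℕ × ℕ × ℕ, ENNReal.ofReal (Real.pi ^ 2 *
      (FScoef n * z₁ ^ n.1 * z₂ ^ n.2.1 * z₃ ^ n.2.2.1 * z₄ ^ n.2.2.2)) := by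
  have hp : ∀ k, 0 < poch (1/2) k := poch_pos (by norm_num)
  have hp1 : ∀ k, 0 < poch 1 k := poch_pos (by norm_num)
  have hm := wt_meas
  let c : ℕ × ℕ × ℕ × ℕ → ℝ := fun n =>
    (poch (1/2) (n.1 + n.2.1) / (Nat.factorial n.1 * Nat.factorial n.2.1) * z₁ ^ n.1 * z₂ ^ n.2.1) *
    (poch (1/2) (n.2.2.1 + n.2.2.2) / (Nat.factorial n.2.2.1 * Nat.factorial n.2.2.2)
      * z₃ ^ n.2.2.1 * z₄ ^ n.2.2.2)
  have hc : ∀ n, 0 ≤ c n := fun n => by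
    have := hp (n.1 + n.2.1)
    have := hp (n.2.2.1 + n.2.2.2)
    simp only [c]; positivity
  have key : ∫⁻ s, ENNReal.ofReal (FF z₁ z₂ z₃ z₄ s) ∂(mu.prod mu) =
    ∫⁻ s, ∑' n : ℕ × ℕ × ℕ × ℕ, ENNReal.ofReal (c n) * (ENNReal.ofReal (s.1 ^ (n.1 + n.2.2.1) * wt s.1)
      * ENNReal.ofReal (s.2 ^ (n.2.1 + n.2.2.2) * wt s.2)) ∂(mu.prod mu) := by
    refine lintegral_congr_ae ?_
    filter_upwards [mu2_ae] with s hs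
    obtain ⟨⟨ha, ha'⟩, ⟨hb, hb'⟩⟩ := id hs
    have hA := lin_le h1 h2 hs.1 hs.2
    have hB := lin_le h3 h4 hs.1 hs.2
    have w1 := wt_nonneg hs.1
    have w2 := wt_nonneg hs.2
    rw [FF, ENNReal.ofReal_mul (by positivity), ENNReal.ofReal_mul (Real.rpow_nonneg (by linarith) _),
      ← binom2 (mul_nonneg h1 ha.le) (mul_nonneg h2 hb.le) (by linarith),
      ← binom2 (mul_nonneg h3 ha.le) (mul_nonneg h4 hb.le) (by linarith),
      ← ENNReal.tsum_mul_right, ← ENNReal.tsum_mul_left, ENNReal.tsum_prod',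
      ENNReal.tsum_prod' (α := ℕ) (β := ℕ × ℕ × ℕ)]
    refine tsum_congr fun a => ?_
    rw [ENNReal.tsum_prod' (α := ℕ) (β := ℕ × ℕ)]
    refine tsum_congr fun b => ?_
    rw [← ENNReal.tsum_mul_left, ← ENNReal.tsum_mul_left]
    refine tsum_congr fun q => ?_
    have := hp (a + b)
    have := hp (q.1 + q.2)
    rw [← ENNReal.ofReal_mul (by positivity), ← ENNReal.ofReal_mul (by positivity),
      ← ENNReal.ofReal_mul (by positivity), ← ENNReal.ofReal_mul (hc _)]
    congr 1
    simp only [c]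
    ring
  rw [key, lintegral_tsum (fun n => by fun_prop)]
  refine tsum_congr fun n => ?_
  rw [lintegral_const_mul _ (by fun_prop),
    lintegral_prod_mul (f := fun x => ENNReal.ofReal (x ^ (n.1 + n.2.2.1) * wt x))
      (g := fun x => ENNReal.ofReal (x ^ (n.2.1 + n.2.2.2) * wt x)) (by fun_prop) (by fun_prop)]
  have q1 := hp (n.1 + n.2.2.1)
  have q2 := hp1 (n.1 + n.2.2.1)
  have q3 := hp (n.2.1 + n.2.2.2)
  have q4 := hp1 (n.2.1 + n.2.2.2)
  rw [mu, beta_lint, beta_lint, ← ENNReal.ofReal_mul (by positivity), ← ENNReal.ofReal_mul (hc _)]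
  congr 1
  simp only [c, FScoef]
  field_simp

end

theorem stmt15 (z₁ z₂ z₃ z₄ : ℝ) (h1 : 0 ≤ z₁) (h2 : 0 ≤ z₂) (h3 : 0 ≤ z₃)
    (h4 : 0 ≤ z₄) (h12 : z₁ + z₂ < 1) (h34 : z₃ + z₄ < 1) :
    (∑' n : ℕ × ℕ × ℕ × ℕ,
        FScoef n * z₁ ^ n.1 * z₂ ^ n.2.1 * z₃ ^ n.2.2.1 * z₄ ^ n.2.2.2)
      = (1 / Real.pi ^ 2) *
        ∫ s₁ in (0 : ℝ)..1, ∫ s₂ in (0 : ℝ)..1,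
          s₁ ^ (-(1 / 2) : ℝ) * s₂ ^ (-(1 / 2) : ℝ) *
            (1 - s₁) ^ (-(1 / 2) : ℝ) * (1 - s₂) ^ (-(1 / 2) : ℝ) *
            (1 - z₁ * s₁ - z₂ * s₂) ^ (-(1 / 2) : ℝ) *
            (1 - z₃ * s₁ - z₄ * s₂) ^ (-(1 / 2) : ℝ) := by
  have hI := FF_int z₁ z₂ z₃ z₄ h1 h2 h3 h4 h12 h34
  have hcoef : ∀ n : ℕ × ℕ × ℕ × ℕ, 0 ≤ Real.pi ^ 2 *
      (FScoef n * z₁ ^ n.1 * z₂ ^ n.2.1 * z₃ ^ n.2.2.1 * z₄ ^ n.2.2.2) := fun n => by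
    have hp : ∀ k, 0 < poch (1/2) k := poch_pos (by norm_num)
    have hp1 : ∀ k, 0 < poch 1 k := poch_pos (by norm_num)
    have q1 := hp (n.1 + n.2.2.1)
    have q2 := hp1 (n.1 + n.2.2.1)
    have q3 := hp (n.2.1 + n.2.2.2)
    have q4 := hp1 (n.2.1 + n.2.2.2)
    have q5 := hp (n.1 + n.2.1)
    have q6 := hp (n.2.2.1 + n.2.2.2)
    unfold FScoef
    positivity
  have e : ∫ s, FF z₁ z₂ z₃ z₄ s ∂(mu.prod mu) = Real.pi ^ 2 * ∑' n : ℕ × ℕ × ℕ × ℕ,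
        FScoef n * z₁ ^ n.1 * z₂ ^ n.2.1 * z₃ ^ n.2.2.1 * z₄ ^ n.2.2.2 := by
    rw [integral_eq_lintegral_of_nonneg_ae (FF_nonneg z₁ z₂ z₃ z₄ h1 h2 h3 h4 h12 h34) hI.1,
      FF_lint z₁ z₂ z₃ z₄ h1 h2 h3 h4 h12 h34,
      ENNReal.tsum_toReal_eq (fun n => ENNReal.ofReal_ne_top), ← tsum_mul_left]
    exact tsum_congr fun n => ENNReal.toReal_ofReal (hcoef n)
  rw [integral_prod _ hI] at e
  have e2 : (∫ s₁ in (0 : ℝ)..1, ∫ s₂ in (0 : ℝ)..1,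
          s₁ ^ (-(1 / 2) : ℝ) * s₂ ^ (-(1 / 2) : ℝ) *
            (1 - s₁) ^ (-(1 / 2) : ℝ) * (1 - s₂) ^ (-(1 / 2) : ℝ) *
            (1 - z₁ * s₁ - z₂ * s₂) ^ (-(1 / 2) : ℝ) *
            (1 - z₃ * s₁ - z₄ * s₂) ^ (-(1 / 2) : ℝ)) =
      ∫ x, ∫ y, FF z₁ z₂ z₃ z₄ (x, y) ∂mu ∂mu := by
    simp only [intervalIntegral.integral_of_le zero_le_one, integral_Ioc_eq_integral_Ioo, mu]
    congr 1; ext x; congr 1; ext y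
    simp only [FF, wt]; ring
  rw [e2, e]
  have := Real.pi_pos
  field_simp
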